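/- Let 𝒜 be a finite alphabet and ℱ ⊆ 𝒜⁺ a set of forbidden factors. Suppose there exists a real β ≥ 1 such that |𝒜| > β + Σ_{f∈ℱ} β^{1−|f|}. Then the growth rate α̊(𝒜,ℱ) := lim_{n→∞} |L̊_n(𝒜,ℱ)|^{1/n} of the circularly ℱ-free words exists, equals the growth rate α(𝒜,ℱ) of ℒ(𝒜,ℱ), and satisfies α̊(𝒜,ℱ) ≥ β. -/

import Mathlib

open Filter

/-- The set of words of length `n` over `A` avoiding every factor in `F`. -/
def langN {A : Type*} (F : Set (List A)) (n : ℕ) : Set (List A) :=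
  {w | w.length = n ∧ ∀ f ∈ F, ¬ f <:+: w}

/-- The set of circularly `F`-free words of length `n` over `A`:
every rotation (conjugate) of the word avoids all factors in `F`. -/
def clangN {A : Type*} (F : Set (List A)) (n : ℕ) : Set (List A) :=
  {w | w.length = n ∧ ∀ k : ℕ, ∀ f ∈ F, ¬ f <:+: w.rotate k}

section Analytic

variable {ι : Type*} {t : ι → ℕ} {β b : ℝ}

lemma inv_pow_tangent_le (hβ : 0 < β) (hb : β ≤ b) (k : ℕ) :
    (b⁻¹) ^ k + (k * (b⁻¹) ^ (k + 1)) * (b - β) ≤ (β⁻¹) ^ k := by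
  have hb0 : 0 < b := hβ.trans_le hb
  have h1 : 1 + (k : ℝ) * ((b - β) / b) ≤ (b / β) ^ k := by
    have h2 : (b - β) / b ≤ (b - β) / β :=
      div_le_div_of_nonneg_left (sub_nonneg.2 hb) hβ hb
    have h3 : (0 : ℝ) ≤ (b - β) / β := div_nonneg (sub_nonneg.2 hb) hβ.le
    calc 1 + (k : ℝ) * ((b - β) / b) ≤ 1 + k * ((b - β) / β) := by gcongr
      _ ≤ (1 + (b - β) / β) ^ k := one_add_mul_le_pow (by linarith) k
      _ = (b / β) ^ k := by congr 1; field_simp; ring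
  have h4 := mul_le_mul_of_nonneg_left h1 (pow_nonneg (inv_nonneg.2 hb0.le) k)
  have h5 : (b⁻¹) ^ k * (b / β) ^ k = (β⁻¹) ^ k := by
    rw [← mul_pow]; congr 1; field_simp
  rw [h5] at h4
  refine le_trans (le_of_eq ?_) h4
  rw [pow_succ]
  field_simp

/-- Convexity of `x ↦ x + ∑ x ^ (-t i)`: past a point where it is below `M` there is a point
where it equals `M`, and its derivative there is positive. -/
lemma exists_tsum_inv_pow_eq {M : ℝ} (hβ : 1 ≤ β) (hs : Summable fun i => (β⁻¹) ^ t i)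
    (hM : β + ∑' i, (β⁻¹) ^ t i < M) :
    ∃ b, β < b ∧ (Summable fun i => (b⁻¹) ^ t i) ∧ b + ∑' i, (b⁻¹) ^ t i = M ∧
      (Summable fun i => (t i : ℝ) * (b⁻¹) ^ (t i + 1)) ∧
      ∑' i, (t i : ℝ) * (b⁻¹) ^ (t i + 1) < 1 := by
  have hβ0 : 0 < β := by linarith
  have hle : ∀ i, ∀ x ∈ Set.Icc β M, ‖(x⁻¹) ^ t i‖ ≤ (β⁻¹) ^ t i := by
    intro i x hx
    have hx0 : 0 < x := hβ0.trans_le hx.1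
    rw [Real.norm_of_nonneg (by positivity)]
    gcongr
    exact hx.1
  have hcont : ContinuousOn (fun x : ℝ => x + ∑' i, (x⁻¹) ^ t i) (Set.Icc β M) := by
    refine continuousOn_id.add (continuousOn_tsum (fun i => ?_) hs hle)
    exact (continuousOn_inv₀.mono fun x hx => (hβ0.trans_le hx.1).ne').pow _
  have hβM : β ≤ M := by
    have : 0 ≤ ∑' i, (β⁻¹) ^ t i := tsum_nonneg fun i => by positivity
    linarith
  have hM0 : 0 < M := hβ0.trans_le hβM
  obtain ⟨b, hb, hbM⟩ := intermediate_value_Icc hβM hcont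
    ⟨hM.le, le_add_of_nonneg_right (tsum_nonneg fun i => by positivity)⟩
  have hb0 : 0 < b := hβ0.trans_le hb.1
  have hlt : β < b := by
    refine lt_of_le_of_ne hb.1 ?_
    rintro rfl
    exact hM.ne hbM
  have hsb : Summable fun i => (b⁻¹) ^ t i := .of_norm_bounded hs fun i => hle i b hb
  have htan := fun i => inv_pow_tangent_le hβ0 hb.1 (t i)
  have hsd : Summable fun i => ((t i : ℝ) * (b⁻¹) ^ (t i + 1)) * (b - β) := by
    refine .of_nonneg_of_le (fun i => ?_) (fun i => ?_) hs
    · have := sub_nonneg.2 hb.1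
      positivity
    · have : 0 ≤ (b⁻¹) ^ t i := by positivity
      linarith [htan i]
  have hsd' : Summable fun i => (t i : ℝ) * (b⁻¹) ^ (t i + 1) :=
    (summable_mul_right_iff (sub_pos.2 hlt).ne').1 hsd
  refine ⟨b, hlt, hsb, hbM, hsd', ?_⟩
  have h1 := (hsb.add hsd).tsum_le_tsum htan hs
  rw [hsb.tsum_add hsd, tsum_mul_right] at h1
  have h2 : (∑' i, (t i : ℝ) * (b⁻¹) ^ (t i + 1)) * (b - β) < 1 * (b - β) := by
    simp only at hbM
    linarith
  exact lt_of_mul_lt_mul_right h2 (sub_pos.2 hlt).le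

end Analytic

section Words

variable {A : Type*} {F : Set (List A)} {b : ℝ}

lemma langN_ncard_sub_le {n k : ℕ} (hb : 0 < b)
    (h : ∀ m < n, b * (langN F m).ncard ≤ (langN F (m + 1)).ncard) (hk : k ≤ n) :
    ((langN F (n - k)).ncard : ℝ) ≤ (b⁻¹) ^ k * (langN F n).ncard := by
  induction k with
  | zero => simp
  | succ k ih =>
    have h1 := h (n - (k + 1)) (by omega)
    rw [show n - (k + 1) + 1 = n - k by omega] at h1
    calc ((langN F (n - (k + 1))).ncard : ℝ)
        = b⁻¹ * (b * (langN F (n - (k + 1))).ncard) := by field_simp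
      _ ≤ b⁻¹ * ((b⁻¹) ^ k * (langN F n).ncard) := by
          exact mul_le_mul_of_nonneg_left (h1.trans (ih (by omega))) (inv_nonneg.2 hb.le)
      _ = _ := by ring

variable (F)

lemma clangN_subset_langN (n : ℕ) : clangN F n ⊆ langN F n :=
  fun w hw => ⟨hw.1, fun f hf => by simpa using hw.2 0 f hf⟩

lemma langN_zero_ncard (hF : ∀ f ∈ F, f ≠ ([] : List A)) : (langN F 0).ncard = 1 := by
  rw [Set.ncard_eq_one]
  refine ⟨[], Set.eq_singleton_iff_unique_mem.2 ⟨⟨rfl, fun f hf h => ?_⟩, fun w hw => ?_⟩⟩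
  · exact hF f hf (List.infix_nil.1 h)
  · exact List.length_eq_zero_iff.1 hw.1

variable [Fintype A]

lemma langN_finite (n : ℕ) : (langN F n).Finite :=
  (List.finite_length_eq A n).subset fun _ hw => hw.1

/-- The forbidden factors of length at most `n`. -/
noncomputable def shortFactors (n : ℕ) : Finset F :=
  ((List.finite_length_le A n).preimage Subtype.val_injective.injOn).toFinset

lemma mem_shortFactors {n : ℕ} {f : F} : f ∈ shortFactors F n ↔ (f : List A).length ≤ n := by
  simp [shortFactors]

lemma langN_ncard_add_le (m n : ℕ) :
    (langN F (m + n)).ncard ≤ (langN F m).ncard * (langN F n).ncard := by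
  rw [← Set.ncard_prod]
  refine Set.ncard_le_ncard_of_injOn (fun w => (w.take m, w.drop m)) ?_ ?_
    ((langN_finite F m).prod (langN_finite F n))
  · rintro w ⟨hw, hwF⟩
    refine ⟨⟨by simp [hw], fun f hf h => ?_⟩, ⟨by simp [hw], fun f hf h => ?_⟩⟩
    · exact hwF f hf (h.trans (List.take_prefix m w).isInfix)
    · exact hwF f hf (h.trans (List.drop_suffix m w).isInfix)
  · intro v _ w _ h
    simp only [Prod.mk.injEq] at h
    rw [← List.take_append_drop m v, ← List.take_append_drop m w, h.1, h.2]

lemma langN_ncard_mul_card_le (hF : ∀ f ∈ F, f ≠ ([] : List A)) (n : ℕ) :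
    (langN F n).ncard * Fintype.card A ≤ (langN F (n + 1)).ncard +
      ∑ f ∈ shortFactors F (n + 1), (langN F (n + 1 - (f : List A).length)).ncard := by
  classical
  have hinj : Function.Injective fun p : List A × A => p.1 ++ [p.2] := by
    rintro ⟨v, a⟩ ⟨w, c⟩ h
    simpa using h
  have himg : ((fun p : List A × A => p.1 ++ [p.2]) '' (langN F n ×ˢ Set.univ)).ncard =
      (langN F n).ncard * Fintype.card A := by
    rw [Set.ncard_image_of_injective _ hinj, Set.ncard_prod, Set.ncard_univ,
      Nat.card_eq_fintype_card]
  have hfin : ∀ f : F, ((· ++ (f : List A)) ''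
      langN F (n + 1 - (f : List A).length)).Finite := fun f => (langN_finite F _).image _
  rw [← himg]
  calc _ ≤ (langN F (n + 1) ∪ ⋃ f ∈ shortFactors F (n + 1),
        (· ++ (f : List A)) '' langN F (n + 1 - (f : List A).length)).ncard := by
        refine Set.ncard_le_ncard ?_ ((langN_finite F _).union
          ((shortFactors F (n + 1)).finite_toSet.biUnion fun f _ => hfin f))
        rintro _ ⟨⟨w, a⟩, ⟨⟨hw, hwF⟩, -⟩, rfl⟩
        replace hw : w.length = n := hw
        by_cases hgood : ∀ f ∈ F, ¬ f <:+: w ++ [a]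
        · exact Or.inl ⟨by simp [hw], hgood⟩
        · push Not at hgood
          obtain ⟨f, hf, hfw⟩ := hgood
          have hsuf := (List.infix_concat_iff.1 hfw).resolve_right (hwF f hf)
          obtain ⟨u, hu⟩ := hsuf
          have hlen : u.length + f.length = n + 1 := by
            simpa [hw] using congrArg List.length hu
          have hfpos := List.length_pos_iff.2 (hF f hf)
          refine Or.inr (Set.mem_biUnion (x := ⟨f, hf⟩) ?_ ⟨u, ⟨?_, fun g hg hgu => ?_⟩, hu⟩)
          · exact (mem_shortFactors F).2 (by simp; omega)
          · simp; omega
          · refine hwF g hg (hgu.trans ?_)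
            have hpre : u <+: w :=
              List.prefix_of_prefix_length_le ⟨f, hu⟩ ⟨[a], rfl⟩ (by omega)
            exact hpre.isInfix
    _ ≤ _ := by
        refine (Set.ncard_union_le _ _).trans (Nat.add_le_add_left ?_ _)
        refine (Finset.set_ncard_biUnion_le _ _).trans (Finset.sum_le_sum fun f _ => ?_)
        exact Set.ncard_image_le (langN_finite F _)

lemma langN_ncard_le_clangN (n : ℕ) :
    (langN F n).ncard ≤ (clangN F n).ncard +
      ∑ f ∈ shortFactors F n, ((f : List A).length - 1) *
        (langN F (n - (f : List A).length)).ncard := by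
  classical
  let wrap : (f : List A) → ℕ → List A → List A :=
    fun f i m => f.drop (i + 1) ++ m ++ f.take (i + 1)
  have hfin : ∀ (f : F) (i : ℕ), (wrap f i '' langN F (n - (f : List A).length)).Finite :=
    fun f i => (langN_finite F _).image _
  calc _ ≤ (clangN F n ∪ ⋃ f ∈ shortFactors F n,
        ⋃ i ∈ Finset.range ((f : List A).length - 1),
          wrap f i '' langN F (n - (f : List A).length)).ncard := by
        refine Set.ncard_le_ncard ?_ (((langN_finite F n).subset (clangN_subset_langN F n)).union
          ((shortFactors F n).finite_toSet.biUnion fun f _ =>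
            (Finset.finite_toSet _).biUnion fun i _ => hfin f i))
        rintro w ⟨hw, hwF⟩
        by_cases hgood : ∀ k : ℕ, ∀ f ∈ F, ¬ f <:+: w.rotate k
        · exact Or.inl ⟨hw, hgood⟩
        push Not at hgood
        obtain ⟨k, f, hf, hfw⟩ := hgood
        rw [List.rotate_eq_drop_append_take_mod, List.infix_append_iff_ne_nil] at hfw
        obtain h | h | ⟨p, s, hp, hs, rfl, ⟨y, hy⟩, ⟨x, hx⟩⟩ := hfw
        · exact absurd (h.trans (List.drop_suffix _ w).isInfix) (hwF f hf)
        · exact absurd (h.trans (List.take_prefix _ w).isInfix) (hwF f hf)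
        have hwe : w = s ++ (x ++ y) ++ p := by
          rw [← List.take_append_drop (k % w.length) w, ← hy, ← hx]
          simp
        have hp' := List.length_pos_iff.2 hp
        have hs' := List.length_pos_iff.2 hs
        have hlen : s.length + (x.length + y.length) + p.length = n := by
          rw [← hw, hwe]
          simp only [List.length_append]
        refine Or.inr (Set.mem_biUnion (x := ⟨p ++ s, hf⟩) ?_
          (Set.mem_biUnion (x := p.length - 1) ?_ ⟨x ++ y, ⟨?_, fun g hg hgu => ?_⟩, ?_⟩))
        · exact (mem_shortFactors F).2 (by simp only [List.length_append]; omega)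
        · simp only [List.length_append, Finset.coe_range, Set.mem_Iio]; omega
        · simp only [List.length_append]; omega
        · exact hwF g hg (hgu.trans ⟨s, p, hwe.symm⟩)
        · simp only [wrap, Nat.sub_add_cancel hp', List.drop_left, List.take_left]
          exact hwe.symm
    _ ≤ _ := by
        refine (Set.ncard_union_le _ _).trans (Nat.add_le_add_left ?_ _)
        refine (Finset.set_ncard_biUnion_le _ _).trans (Finset.sum_le_sum fun f _ => ?_)
        refine (Finset.set_ncard_biUnion_le _ _).trans ?_
        refine (Finset.sum_le_card_nsmul _ _ _
          fun i _ => Set.ncard_image_le (langN_finite F _)).trans ?_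
        simp

variable {F}

lemma mul_langN_ncard_le (hF : ∀ f ∈ F, f ≠ ([] : List A)) (hb : 0 < b)
    (hs : Summable fun f : F => (b⁻¹) ^ ((f : List A).length - 1))
    (hM : b + ∑' f : F, (b⁻¹) ^ ((f : List A).length - 1) ≤ Fintype.card A) (n : ℕ) :
    b * (langN F n).ncard ≤ (langN F (n + 1)).ncard := by
  induction n using Nat.strong_induction_on with
  | _ n ih =>
  have h1 : ((langN F n).ncard : ℝ) * Fintype.card A ≤ (langN F (n + 1)).ncard +
      ∑ f ∈ shortFactors F (n + 1), ((langN F (n + 1 - (f : List A).length)).ncard : ℝ) := by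
    exact_mod_cast langN_ncard_mul_card_le F hF n
  have h2 : ∑ f ∈ shortFactors F (n + 1), ((langN F (n + 1 - (f : List A).length)).ncard : ℝ) ≤
      (∑' f : F, (b⁻¹) ^ ((f : List A).length - 1)) * (langN F n).ncard := by
    calc _ ≤ ∑ f ∈ shortFactors F (n + 1),
          (b⁻¹) ^ ((f : List A).length - 1) * ((langN F n).ncard : ℝ) := by
          refine Finset.sum_le_sum fun f hf => ?_
          have hf1 := (mem_shortFactors F).1 hf
          have hf2 := List.length_pos_iff.2 (hF f f.2)
          rw [show n + 1 - (f : List A).length = n - ((f : List A).length - 1) by omega]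
          exact langN_ncard_sub_le hb ih (by omega)
      _ ≤ _ := by
          rw [← Finset.sum_mul]
          gcongr
          exact hs.sum_le_tsum _ fun f _ => by positivity
  have h3 := mul_le_mul_of_nonneg_right hM (Nat.cast_nonneg (α := ℝ) (langN F n).ncard)
  linarith

lemma mul_langN_ncard_le_clangN (hF : ∀ f ∈ F, f ≠ ([] : List A)) (hb : 0 < b)
    (h : ∀ n, b * (langN F n).ncard ≤ (langN F (n + 1)).ncard)
    (hs : Summable fun f : F =>
      (((f : List A).length - 1 : ℕ) : ℝ) * (b⁻¹) ^ ((f : List A).length - 1 + 1)) (n : ℕ) :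
    (1 - ∑' f : F, (((f : List A).length - 1 : ℕ) : ℝ) * (b⁻¹) ^ ((f : List A).length - 1 + 1)) *
      (langN F n).ncard ≤ (clangN F n).ncard := by
  have h1 : ((langN F n).ncard : ℝ) ≤ (clangN F n).ncard +
      ∑ f ∈ shortFactors F n, (((f : List A).length - 1 : ℕ) : ℝ) *
        ((langN F (n - (f : List A).length)).ncard : ℝ) := by
    exact_mod_cast langN_ncard_le_clangN F n
  have h2 : ∑ f ∈ shortFactors F n, (((f : List A).length - 1 : ℕ) : ℝ) *
        ((langN F (n - (f : List A).length)).ncard : ℝ) ≤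
      (∑' f : F, (((f : List A).length - 1 : ℕ) : ℝ) * (b⁻¹) ^ ((f : List A).length - 1 + 1)) *
        (langN F n).ncard := by
    calc _ ≤ ∑ f ∈ shortFactors F n, ((((f : List A).length - 1 : ℕ) : ℝ) *
          (b⁻¹) ^ ((f : List A).length - 1 + 1)) * ((langN F n).ncard : ℝ) := by
          refine Finset.sum_le_sum fun f hf => ?_
          rw [mul_assoc, Nat.sub_add_cancel (List.length_pos_iff.2 (hF f f.2))]
          gcongr
          exact langN_ncard_sub_le hb (fun m _ => h m) ((mem_shortFactors F).1 hf)
      _ ≤ _ := by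
          rw [← Finset.sum_mul]
          gcongr
          exact hs.sum_le_tsum _ fun f _ => by positivity
  linarith

end Words

/-- Fekete's lemma in multiplicative form. -/
lemma exists_tendsto_rpow_one_div {u : ℕ → ℝ} (h1 : ∀ n, 1 ≤ u n)
    (hmul : ∀ m n, u (m + n) ≤ u m * u n) :
    ∃ a, Tendsto (fun n : ℕ => u n ^ (1 / (n : ℝ))) atTop (nhds a) := by
  have hpos : ∀ n, 0 < u n := fun n => zero_lt_one.trans_le (h1 n)
  have hsub : Subadditive fun n => Real.log (u n) := fun m n => by
    rw [← Real.log_mul (hpos m).ne' (hpos n).ne']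
    exact Real.log_le_log (hpos _) (hmul m n)
  have hbdd : BddBelow (Set.range fun n : ℕ => Real.log (u n) / n) := by
    refine ⟨0, ?_⟩
    rintro _ ⟨n, rfl⟩
    exact div_nonneg (Real.log_nonneg (h1 n)) n.cast_nonneg
  refine ⟨Real.exp hsub.lim, ((Real.continuous_exp.tendsto _).comp
    (hsub.tendsto_lim hbdd)).congr fun n => ?_⟩
  simp [Real.rpow_def_of_pos (hpos n), div_eq_mul_inv]

/-- A sequence comparable to `u` up to constant factors has the same growth rate as `u`. -/
lemma tendsto_rpow_one_div_of_le {u v : ℕ → ℝ} {a δ : ℝ} (hδ : 0 < δ) (hu : ∀ n, 0 ≤ u n)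
    (hlow : ∀ n, δ * u n ≤ v n) (hup : ∀ n, v n ≤ u n)
    (ha : Tendsto (fun n : ℕ => u n ^ (1 / (n : ℝ))) atTop (nhds a)) :
    Tendsto (fun n : ℕ => v n ^ (1 / (n : ℝ))) atTop (nhds a) := by
  have hδ1 : Tendsto (fun n : ℕ => δ ^ (1 / (n : ℝ))) atTop (nhds 1) := by
    simpa [Function.comp_def] using (Real.continuousAt_const_rpow hδ.ne').tendsto.comp
      (tendsto_one_div_atTop_nhds_zero_nat (𝕜 := ℝ))
  have hlow' : Tendsto (fun n : ℕ => (δ * u n) ^ (1 / (n : ℝ))) atTop (nhds a) := by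
    simpa using (hδ1.mul ha).congr fun n => (Real.mul_rpow hδ.le (hu n)).symm
  have hδu : ∀ n, 0 ≤ δ * u n := fun n => mul_nonneg hδ.le (hu n)
  refine tendsto_of_tendsto_of_tendsto_of_le_of_le hlow' ha (fun n => ?_) (fun n => ?_)
  · exact Real.rpow_le_rpow (hδu n) (hlow n) (by positivity)
  · exact Real.rpow_le_rpow ((hδu n).trans (hlow n)) (hup n) (by positivity)

/-- If there is `β ≥ 1` with `|𝒜| > β + Σ_{f∈ℱ} β^(1−|f|)`, then the growth rate
`α̊(𝒜,ℱ) = lim_n |L̊_n(𝒜,ℱ)|^(1/n)` of the circularly `ℱ`-free words exists,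
equals the growth rate `α(𝒜,ℱ) = lim_n |ℒ_n(𝒜,ℱ)|^(1/n)`, and satisfies
`α̊(𝒜,ℱ) ≥ β`. -/
theorem stmt16 {A : Type*} [Fintype A] (F : Set (List A))
    (hF : ∀ f ∈ F, f ≠ ([] : List A)) (β : ℝ) (hβ : 1 ≤ β)
    (hsum : Summable fun f : F => β ^ ((1 : ℤ) - ((f : List A).length : ℤ)))
    (hcond : β + ∑' f : F, β ^ ((1 : ℤ) - ((f : List A).length : ℤ)) < (Fintype.card A : ℝ)) :
    ∃ a : ℝ,
      Tendsto (fun n : ℕ => ((clangN F n).ncard : ℝ) ^ (1 / (n : ℝ))) atTop (nhds a) ∧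
      Tendsto (fun n : ℕ => ((langN F n).ncard : ℝ) ^ (1 / (n : ℝ))) atTop (nhds a) ∧
      β ≤ a := by
  have hzpow : ∀ f : F, β ^ ((1 : ℤ) - ((f : List A).length : ℤ)) =
      (β⁻¹) ^ ((f : List A).length - 1) := fun f => by
    have := List.length_pos_iff.2 (hF f f.2)
    rw [inv_pow, ← zpow_natCast, ← zpow_neg]
    congr 1
    omega
  simp only [hzpow] at hsum hcond
  obtain ⟨b, hβb, hsb, hbM, hsd, hlt⟩ := exists_tsum_inv_pow_eq hβ hsum hcond
  have hb0 : 0 < b := by linarith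
  have hgrow := mul_langN_ncard_le hF hb0 hsb hbM.le
  have hpow : ∀ n, b ^ n ≤ (langN F n).ncard := by
    intro n
    induction n with
    | zero => simp [langN_zero_ncard F hF]
    | succ n ih =>
      rw [pow_succ']
      exact (mul_le_mul_of_nonneg_left ih hb0.le).trans (hgrow n)
  obtain ⟨a, ha⟩ := exists_tendsto_rpow_one_div (u := fun n => ((langN F n).ncard : ℝ))
    (fun n => (one_le_pow₀ (by linarith)).trans (hpow n))
    (fun m n => by exact_mod_cast langN_ncard_add_le F m n)
  refine ⟨a, ?_, ha, ?_⟩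
  · refine tendsto_rpow_one_div_of_le (sub_pos.2 hlt) (fun n => Nat.cast_nonneg _)
      (mul_langN_ncard_le_clangN hF hb0 hgrow hsd) (fun n => ?_) ha
    exact_mod_cast Set.ncard_le_ncard (clangN_subset_langN F n) (langN_finite F n)
  · refine hβb.le.trans (ge_of_tendsto ha ?_)
    filter_upwards [eventually_ne_atTop 0] with n hn
    rw [one_div]
    calc b = (b ^ n) ^ ((n : ℝ)⁻¹) := (Real.pow_rpow_inv_natCast hb0.le hn).symm
      _ ≤ _ := Real.rpow_le_rpow (by positivity) (hpow n) (by positivity)
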